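/- Local mollification near a rigid map (Lemma B.1 of the paper, with the scaling of the hypothesis made dimensionally consistent). Let ρ : ℝ² → ℝ be smooth, nonnegative, supported in the closed unit ball, with ∫_{ℝ²} ρ = 1 and ρ(−y) = ρ(y) for all y; for ε > 0 set ρ_ε(y) := ε^{−2}ρ(y/ε). Then there exists a constant C > 0, depending only on ρ, with the following property: for every ε > 0, η > 0, x₀ ∈ ℝ², n ≥ 1, every C² map f : ℝ² → ℝⁿ, and every affine isometric embedding P : ℝ² → ℝⁿ (i.e., P(y) = T(y) + p₀ with T : ℝ² → ℝⁿ a linear isometric embedding and p₀ ∈ ℝⁿ) satisfying ε^{−2}‖f − P‖_{L²(B_{2ε}(x₀))} + ‖D²f‖_{L²(B_{2ε}(x₀))} ≤ η, the mollification f_ε := f ∗ ρ_ε satisfies ε^{−1}·sup_{B_ε(x₀)}|f_ε − P| + sup_{B_ε(x₀)}‖D(f_ε − P)‖ ≤ Cη. -/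

import Mathlib

open MeasureTheory Metric

noncomputable section

/-- Euclidean ℝ². -/
abbrev E2 := EuclideanSpace ℝ (Fin 2)

/-- Mollification `f ∗ ρ_ε`, where `ρ_ε(y) = ε⁻²ρ(y/ε)`. -/
def mollify {F : Type*} [NormedAddCommGroup F] [NormedSpace ℝ F]
    (ρ : E2 → ℝ) (ε : ℝ) (f : E2 → F) : E2 → F := fun x =>
  ∫ y : E2, (ε ^ (-2 : ℤ) * ρ (ε⁻¹ • y)) • f (x - y)

/-- Cauchy–Schwarz on a ball, against the constant function `1`. -/
theorem setIntegral_norm_ball_le {F : Type*} [NormedAddCommGroup F] {g : E2 → F}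
    (hg : Continuous g) (x : E2) (r : ℝ) :
    ∫ z in ball x r, ‖g z‖ ≤
      √(volume.real (ball x r)) * √(∫ z in ball x r, ‖g z‖ ^ 2) := by
  have hfin : IsFiniteMeasure (volume.restrict (ball x r)) :=
    isFiniteMeasure_restrict.2 measure_ball_lt_top.ne
  obtain ⟨M, hM⟩ := (isCompact_closedBall x r).exists_bound_of_continuousOn hg.norm.continuousOn
  have hgLp : MemLp (fun z => ‖g z‖) (ENNReal.ofReal 2) (volume.restrict (ball x r)) :=
    MemLp.of_bound hg.norm.aestronglyMeasurable M <|
      (ae_restrict_mem measurableSet_ball).mono fun z hz => hM z (ball_subset_closedBall hz)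
  have h := integral_mul_le_Lp_mul_Lq_of_nonneg Real.HolderConjugate.two_two
    (ae_of_all (volume.restrict (ball x r)) fun _ => zero_le_one)
    (ae_of_all _ fun z => norm_nonneg (g z)) (memLp_const (1 : ℝ)) hgLp
  simpa [Real.sqrt_eq_rpow] using h

open Convolution in
theorem norm_convolution_le_of_support_subset_closedBall {W F G : Type*}
    [NormedAddCommGroup W] [NormedSpace ℝ W] [NormedAddCommGroup F] [NormedSpace ℝ F]
    [NormedAddCommGroup G] [NormedSpace ℝ G] (L : W →L[ℝ] F →L[ℝ] G)
    (hL : ∀ w v, ‖L w v‖ ≤ ‖w‖ * ‖v‖)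
    {k : E2 → W} {g : E2 → F} {r M : ℝ} (hk : Function.support k ⊆ closedBall 0 r)
    (hM : ∀ y, ‖k y‖ ≤ M) (hg : Continuous g) {x x₀ : E2} (hx : x ∈ ball x₀ r) :
    ‖(k ⋆[L, volume] g) x‖ ≤ M * (2 * r * √(volume.real (ball (0 : E2) 1)) *
      √(∫ z in ball x₀ (2 * r), ‖g z‖ ^ 2)) := by
  have hr : 0 < r := pos_of_mem_ball hx
  have hM0 : 0 ≤ M := (norm_nonneg _).trans (hM 0)
  have hzero : ∀ z ∉ ball x₀ (2 * r), L (k (x - z)) (g z) = 0 := by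
    intro z hz
    have : k (x - z) = 0 := by
      by_contra hne
      have hxz : ‖x - z‖ ≤ r := by simpa using hk hne
      refine hz ?_
      rw [mem_ball, dist_comm] at *
      have := dist_triangle x₀ x z
      rw [dist_eq_norm x z] at this
      linarith
    simp [this]
  have hgi : IntegrableOn (fun z => ‖g z‖) (ball x₀ (2 * r)) :=
    (hg.norm.continuousOn.integrableOn_compact (isCompact_closedBall x₀ (2 * r))).mono_set
      ball_subset_closedBall
  have hvol : √(volume.real (ball x₀ (2 * r))) = 2 * r * √(volume.real (ball (0 : E2) 1)) := by
    rw [measureReal_def, Measure.addHaar_ball _ _ (by positivity), finrank_euclideanSpace_fin,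
      ENNReal.toReal_mul, ENNReal.toReal_ofReal (by positivity), Real.sqrt_mul (by positivity),
      Real.sqrt_sq (by positivity), measureReal_def]
  rw [convolution_eq_swap, ← setIntegral_eq_integral_of_forall_compl_eq_zero hzero, ← hvol]
  calc _ ≤ ∫ z in ball x₀ (2 * r), M * ‖g z‖ := by
        refine norm_integral_le_of_norm_le (hgi.const_mul M) (ae_of_all _ fun z => ?_)
        refine (hL _ _).trans ?_
        gcongr
        exact hM _
    _ ≤ _ := by
        rw [integral_const_mul]
        gcongr
        exact setIntegral_norm_ball_le hg _ _

theorem integral_smul_linear_of_even {F : Type*} [NormedAddCommGroup F] [NormedSpace ℝ F]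
    {k : E2 → ℝ} (hk : ∀ y, k (-y) = k y) (T : E2 →L[ℝ] F) : ∫ y, k y • T y = 0 := by
  have h := integral_neg_eq_self (fun y => k y • T y) volume
  simp only [hk, map_neg, smul_neg, integral_neg] at h
  have h₂ : (2 : ℝ) • ∫ y, k y • T y = 0 := by
    rw [two_smul]
    nth_rewrite 1 [← h]
    exact neg_add_cancel _
  exact (smul_eq_zero.1 h₂).resolve_left two_ne_zero

/-- The rescaled kernel `ε⁻² ρ(·/ε)`. -/
def rescaledKernel (ρ : E2 → ℝ) (ε : ℝ) (y : E2) : ℝ := ε ^ (-2 : ℤ) * ρ (ε⁻¹ • y)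

section rescaledKernel

variable {ρ : E2 → ℝ} {ε : ℝ}

theorem integral_rescaledKernel (hε : 0 < ε) : ∫ y, rescaledKernel ρ ε y = ∫ y, ρ y := by
  simp only [rescaledKernel]
  rw [integral_const_mul, Measure.integral_comp_smul, finrank_euclideanSpace_fin, smul_eq_mul,
    ← mul_assoc, abs_of_pos (by positivity)]
  field_simp

theorem tsupport_rescaledKernel_subset (hρ : Function.support ρ ⊆ closedBall 0 1) (hε : 0 < ε) :
    tsupport (rescaledKernel ρ ε) ⊆ closedBall 0 ε := by
  refine closure_minimal (fun y hy => ?_) isClosed_closedBall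
  have h : ‖ε⁻¹ • y‖ ≤ 1 := by
    simpa using hρ (show ρ (ε⁻¹ • y) ≠ 0 from right_ne_zero_of_mul hy)
  rw [norm_smul, norm_inv, Real.norm_of_nonneg hε.le, inv_mul_le_iff₀ hε, mul_one] at h
  simpa using h

theorem hasCompactSupport_rescaledKernel (hρ : Function.support ρ ⊆ closedBall 0 1)
    (hε : 0 < ε) : HasCompactSupport (rescaledKernel ρ ε) :=
  (isCompact_closedBall 0 ε).of_isClosed_subset (isClosed_tsupport _)
    (tsupport_rescaledKernel_subset hρ hε)

theorem contDiff_rescaledKernel {n : WithTop ℕ∞} (hρ : ContDiff ℝ n ρ) :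
    ContDiff ℝ n (rescaledKernel ρ ε) :=
  contDiff_const.mul (hρ.comp (contDiff_id.const_smul _))

theorem norm_rescaledKernel_le {M : ℝ} (hM : ∀ y, ‖ρ y‖ ≤ M) (hε : 0 < ε) (y : E2) :
    ‖rescaledKernel ρ ε y‖ ≤ ε ^ (-2 : ℤ) * M := by
  rw [rescaledKernel, norm_mul, Real.norm_of_nonneg (by positivity)]
  gcongr
  exact hM _

theorem norm_fderiv_rescaledKernel_le (hρ : Differentiable ℝ ρ) {M : ℝ}
    (hM : ∀ y, ‖fderiv ℝ ρ y‖ ≤ M) (hε : 0 < ε) (y : E2) :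
    ‖fderiv ℝ (rescaledKernel ρ ε) y‖ ≤ ε ^ (-2 : ℤ) * (ε⁻¹ * M) := by
  have h : fderiv ℝ (rescaledKernel ρ ε) y
      = ε ^ (-2 : ℤ) • ε⁻¹ • fderiv ℝ ρ (ε⁻¹ • y) := by
    rw [← fderiv_comp_smul]
    exact fderiv_const_mul (by fun_prop) _
  rw [h, norm_smul, norm_smul, Real.norm_of_nonneg (by positivity),
    Real.norm_of_nonneg (by positivity)]
  gcongr
  exact hM _

open Convolution in
theorem mollify_eq_convolution {F : Type*} [NormedAddCommGroup F] [NormedSpace ℝ F]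
    (f : E2 → F) :
    mollify ρ ε f = rescaledKernel ρ ε ⋆[ContinuousLinearMap.lsmul ℝ ℝ, volume] f :=
  rfl

theorem mollify_sub_affine {F : Type*} [NormedAddCommGroup F] [NormedSpace ℝ F] [CompleteSpace F]
    (hρ : Continuous ρ) (hsupp : Function.support ρ ⊆ closedBall 0 1) (hρint : ∫ y, ρ y = 1)
    (hsymm : ∀ y, ρ (-y) = ρ y) (hε : 0 < ε) {f : E2 → F} (hf : Continuous f)
    (T : E2 →L[ℝ] F) (p : F) (x : E2) :
    mollify ρ ε f x - (T x + p) = mollify ρ ε (fun y => f y - (T y + p)) x := by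
  have hk : Continuous (rescaledKernel ρ ε) :=
    continuous_const.mul (hρ.comp (continuous_const_smul _))
  have hkc := hasCompactSupport_rescaledKernel hsupp hε
  have hi {g : E2 → F} (hg : Continuous g) : Integrable fun y => rescaledKernel ρ ε y • g y :=
    (hk.smul hg).integrable_of_hasCompactSupport hkc.smul_right
  have hodd : ∫ y, rescaledKernel ρ ε y • T y = 0 :=
    integral_smul_linear_of_even (fun y => by simp [rescaledKernel, hsymm]) T
  have haff : ∫ y, rescaledKernel ρ ε y • (T (x - y) + p) = T x + p := by
    have h (y : E2) : rescaledKernel ρ ε y • (T (x - y) + p)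
        = rescaledKernel ρ ε y • (T x + p) - rescaledKernel ρ ε y • T y := by
      rw [map_sub]; module
    simp_rw [h]
    rw [integral_sub (hi continuous_const) (hi T.continuous), hodd, integral_smul_const,
      integral_rescaledKernel hε, hρint, one_smul, sub_zero]
  change (∫ y, rescaledKernel ρ ε y • f (x - y)) - _
    = ∫ y, rescaledKernel ρ ε y • (f (x - y) - (T (x - y) + p))
  simp_rw [smul_sub]
  rw [integral_sub (hi (by fun_prop)) (hi (by fun_prop)), haff]

theorem norm_mollify_le {F : Type*} [NormedAddCommGroup F] [NormedSpace ℝ F]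
    (hsupp : Function.support ρ ⊆ closedBall 0 1) {M : ℝ} (hM : ∀ y, ‖ρ y‖ ≤ M)
    {g : E2 → F} (hg : Continuous g) {x x₀ : E2} (hε : 0 < ε) (hx : x ∈ ball x₀ ε) :
    ‖mollify ρ ε g x‖ ≤ ε ^ (-2 : ℤ) * M * (2 * ε * √(volume.real (ball (0 : E2) 1)) *
      √(∫ z in ball x₀ (2 * ε), ‖g z‖ ^ 2)) := by
  rw [mollify_eq_convolution]
  exact norm_convolution_le_of_support_subset_closedBall _ (fun c v => (norm_smul c v).le)
    ((subset_tsupport _).trans (tsupport_rescaledKernel_subset hsupp hε))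
    (norm_rescaledKernel_le hM hε) hg hx

theorem norm_fderiv_mollify_le {F : Type*} [NormedAddCommGroup F] [NormedSpace ℝ F]
    [CompleteSpace F] (hρ : ContDiff ℝ 1 ρ) (hsupp : Function.support ρ ⊆ closedBall 0 1)
    {M : ℝ} (hM : ∀ y, ‖fderiv ℝ ρ y‖ ≤ M)
    {g : E2 → F} (hg : Continuous g) {x x₀ : E2} (hε : 0 < ε) (hx : x ∈ ball x₀ ε) :
    ‖fderiv ℝ (mollify ρ ε g) x‖ ≤ ε ^ (-2 : ℤ) * (ε⁻¹ * M) *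
      (2 * ε * √(volume.real (ball (0 : E2) 1)) *
        √(∫ z in ball x₀ (2 * ε), ‖g z‖ ^ 2)) := by
  rw [mollify_eq_convolution,
    ((hasCompactSupport_rescaledKernel hsupp hε).hasFDerivAt_convolution_left _
      (contDiff_rescaledKernel hρ) hg.locallyIntegrable x).fderiv]
  refine norm_convolution_le_of_support_subset_closedBall _ (fun w v => ?_)
    ((support_fderiv_subset ℝ).trans (tsupport_rescaledKernel_subset hsupp hε))
    (norm_fderiv_rescaledKernel_le (hρ.differentiable one_ne_zero) hM hε) hg hx
  refine ContinuousLinearMap.opNorm_le_bound _ (by positivity) fun u => ?_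
  rw [ContinuousLinearMap.precompL_apply, ContinuousLinearMap.lsmul_apply, norm_smul,
    mul_right_comm]
  gcongr
  exact w.le_opNorm u

end rescaledKernel

/-- **Local mollification near a rigid map** (Lemma B.1 of the paper, with the
scaling of the hypothesis made dimensionally consistent). -/
theorem local_mollification_near_rigid_map
    (ρ : E2 → ℝ)
    (hρ_smooth : ContDiff ℝ (⊤ : ℕ∞) ρ)
    (hρ_nonneg : ∀ y, 0 ≤ ρ y)
    (hρ_supp : Function.support ρ ⊆ closedBall 0 1)
    (hρ_int : ∫ y : E2, ρ y = 1)
    (hρ_symm : ∀ y, ρ (-y) = ρ y) :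
    ∃ C > (0 : ℝ),
      ∀ (ε : ℝ), 0 < ε → ∀ (η : ℝ), 0 < η → ∀ (x₀ : E2) (n : ℕ), 1 ≤ n →
        ∀ f : E2 → EuclideanSpace ℝ (Fin n), ContDiff ℝ 2 f →
        ∀ (T : E2 →ₗᵢ[ℝ] EuclideanSpace ℝ (Fin n)) (p₀ : EuclideanSpace ℝ (Fin n)),
          ε ^ (-2 : ℤ) *
              Real.sqrt (∫ y in ball x₀ (2 * ε), ‖f y - (T y + p₀)‖ ^ 2) +
            Real.sqrt (∫ y in ball x₀ (2 * ε), ‖fderiv ℝ (fderiv ℝ f) y‖ ^ 2) ≤ η →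
          ε⁻¹ * (⨆ x : ball x₀ ε, ‖mollify ρ ε f x - (T (x : E2) + p₀)‖) +
              (⨆ x : ball x₀ ε,
                ‖fderiv ℝ (fun y => mollify ρ ε f y - (T y + p₀)) (x : E2)‖)
            ≤ C * η := by
  have hρ1 : ContDiff ℝ 1 ρ := hρ_smooth.of_le (by exact_mod_cast le_top)
  have hρ_cpt : HasCompactSupport ρ :=
    HasCompactSupport.intro (isCompact_closedBall 0 1) fun y hy =>
      Function.notMem_support.1 fun h => hy (hρ_supp h)
  obtain ⟨M₀, hM₀⟩ := hρ_cpt.exists_bound_of_continuous hρ1.continuous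
  obtain ⟨M₁, hM₁⟩ := (hρ_cpt.fderiv ℝ).exists_bound_of_continuous
    (hρ1.continuous_fderiv one_ne_zero)
  have hM₀0 : 0 ≤ M₀ := (norm_nonneg _).trans (hM₀ 0)
  have hM₁0 : 0 ≤ M₁ := (norm_nonneg _).trans (hM₁ 0)
  set m := √(volume.real (ball (0 : E2) 1))
  have hm : 0 ≤ m := Real.sqrt_nonneg _
  refine ⟨2 * M₀ * m + 2 * M₁ * m + 1, by positivity, ?_⟩
  intro ε hε η hη x₀ n _ f hf T p₀ hle
  set g : E2 → EuclideanSpace ℝ (Fin n) := fun y => f y - (T y + p₀)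
  have hg : Continuous g := by fun_prop
  have hmol : (fun y => mollify ρ ε f y - (T y + p₀)) = mollify ρ ε g := funext fun y =>
    mollify_sub_affine hρ1.continuous hρ_supp hρ_int hρ_symm hε hf.continuous
      T.toContinuousLinearMap p₀ y
  set I := √(∫ y in ball x₀ (2 * ε), ‖g y‖ ^ 2)
  have hI : ε ^ (-2 : ℤ) * I ≤ η := (le_add_of_nonneg_right (Real.sqrt_nonneg _)).trans hle
  have hvalue (x : ball x₀ ε) : ‖mollify ρ ε f x - (T (x : E2) + p₀)‖ ≤ ε * (2 * M₀ * m * η) := by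
    rw [congrFun hmol x]
    calc _ ≤ ε ^ (-2 : ℤ) * M₀ * (2 * ε * m * I) := norm_mollify_le hρ_supp hM₀ hg hε x.2
      _ = ε * (2 * M₀ * m * (ε ^ (-2 : ℤ) * I)) := by ring
      _ ≤ _ := by gcongr
  have hderiv (x : ball x₀ ε) :
      ‖fderiv ℝ (fun y => mollify ρ ε f y - (T y + p₀)) (x : E2)‖ ≤ 2 * M₁ * m * η := by
    rw [hmol]
    calc _ ≤ ε ^ (-2 : ℤ) * (ε⁻¹ * M₁) * (2 * ε * m * I) :=
          norm_fderiv_mollify_le hρ1 hρ_supp hM₁ hg hε x.2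
      _ = (ε⁻¹ * ε) * (2 * M₁ * m * (ε ^ (-2 : ℤ) * I)) := by ring
      _ ≤ _ := by
        rw [inv_mul_cancel₀ hε.ne', one_mul]
        gcongr
  have hsup₀ := Real.iSup_le hvalue (by positivity)
  have hsup₁ := Real.iSup_le hderiv (by positivity)
  calc _ ≤ ε⁻¹ * (ε * (2 * M₀ * m * η)) + 2 * M₁ * m * η := by gcongr
    _ = (2 * M₀ * m + 2 * M₁ * m) * η := by
      rw [inv_mul_cancel_left₀ hε.ne']
      ring
    _ ≤ _ := by
      nlinarith
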